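/- Let T be the number of odd-degree vertices in G(n,p) with (log n)^2/n ≤ p ≤ 1 - (log n)^2/n and let μ = E[T]. For every fixed even integer q ≥ 2 there is a constant D = D(q) such that E[(T - μ)^q] ≤ D · n^{q/2} for all sufficiently large n. -/

import Mathlib

open MeasureTheory

/-- Bernoulli(p) measure on `Bool`. -/
noncomputable def bern (p : ℝ) : Measure Bool :=
  (Real.toNNReal p) • Measure.dirac true + (Real.toNNReal (1 - p)) • Measure.dirac false

instance (p : ℝ) : IsFiniteMeasure (bern p) := by
  unfold bern; infer_instance

/-- The Erdős–Rényi measure: each potential edge (element of `Sym2 (Fin n)`)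
is present (`true`) independently with probability `p`. -/
noncomputable def erMeasure (n : ℕ) (p : ℝ) : Measure (Sym2 (Fin n) → Bool) :=
  Measure.pi fun _ => bern p

/-- The random graph determined by the sample point `ω`. -/
def erGraph (n : ℕ) (ω : Sym2 (Fin n) → Bool) : SimpleGraph (Fin n) :=
  SimpleGraph.fromEdgeSet {e | ω e = true}

/-- Degree of a vertex. -/
noncomputable def degN {V : Type*} (G : SimpleGraph V) (v : V) : ℕ :=
  Nat.card (G.neighborSet v)

/-- Number of odd-degree vertices. -/
noncomputable def oddCount (n : ℕ) (ω : Sym2 (Fin n) → Bool) : ℕ :=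
  Nat.card {v : Fin n // Odd (degN (erGraph n ω) v)}

/-- The sign of an edge indicator: `-1` if the edge is present and `1` otherwise. -/
def edgeSign (b : Bool) : ℝ := if b = true then -1 else 1

open Classical in
/-- The parity sign `(-1) ^ deg v`, written as a product over all potential edges. -/
noncomputable def degreeSign {n : ℕ} (v : Fin n) (ω : Sym2 (Fin n) → Bool) : ℝ :=
  ∏ e : Sym2 (Fin n), if v ∈ e ∧ ¬ e.IsDiag then edgeSign (ω e) else 1

open Classical in
/-- The number of indices of a tuple of vertices that are incident to a potential edge. -/
noncomputable def incidenceCount {n k : ℕ} (v : Fin k → Fin n) (e : Sym2 (Fin n)) : ℕ :=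
  (Finset.univ.filter fun i => v i ∈ e ∧ ¬ e.IsDiag).card

theorem integral_edgeSign_pow {p : ℝ} (h0 : 0 ≤ p) (h1 : p ≤ 1) (c : ℕ) :
    ∫ b, edgeSign b ^ c ∂bern p = p * (-1) ^ c + (1 - p) := by
  unfold bern
  rw [integral_add_measure (.of_finite) (.of_finite), integral_smul_nnreal_measure,
    integral_smul_nnreal_measure, integral_dirac, integral_dirac]
  simp [edgeSign, NNReal.smul_def, h0, h1]

theorem abs_integral_edgeSign_pow_le_one {p : ℝ} (h0 : 0 ≤ p) (h1 : p ≤ 1) (c : ℕ) :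
    |∫ b, edgeSign b ^ c ∂bern p| ≤ 1 := by
  rw [integral_edgeSign_pow h0 h1, abs_le]
  rcases neg_one_pow_eq_or ℝ c with h | h <;> rw [h] <;> constructor <;> linarith

theorem abs_integral_edgeSign_pow_odd {p : ℝ} (h0 : 0 ≤ p) (h1 : p ≤ 1) {c : ℕ} (hc : Odd c) :
    |∫ b, edgeSign b ^ c ∂bern p| = |1 - 2 * p| := by
  rw [integral_edgeSign_pow h0 h1, hc.neg_one_pow]
  congr 1
  ring

theorem isProbabilityMeasure_bern {p : ℝ} (h0 : 0 ≤ p) (h1 : p ≤ 1) :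
    IsProbabilityMeasure (bern p) := by
  constructor
  have : Real.toNNReal p + Real.toNNReal (1 - p) = 1 := by
    rw [← Real.toNNReal_add h0 (by linarith)]
    simp
  simp only [bern, Measure.add_apply, Measure.smul_apply, measure_univ]
  simpa [ENNReal.smul_def] using congrArg ((↑) : NNReal → ENNReal) this

theorem isProbabilityMeasure_erMeasure (n : ℕ) {p : ℝ} (h0 : 0 ≤ p) (h1 : p ≤ 1) :
    IsProbabilityMeasure (erMeasure n p) := by
  have := isProbabilityMeasure_bern h0 h1
  unfold erMeasure
  infer_instance

theorem degreeSign_eq_neg_one_pow {n : ℕ} (v : Fin n) (ω : Sym2 (Fin n) → Bool) :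
    degreeSign v ω = (-1) ^ degN (erGraph n ω) v := by
  classical
  have hcard : degN (erGraph n ω) v =
      (Finset.univ.filter fun e : Sym2 (Fin n) => (v ∈ e ∧ ¬ e.IsDiag) ∧ ω e = true).card := by
    unfold degN
    rw [← Nat.card_congr ((erGraph n ω).incidenceSetEquivNeighborSet v),
      Nat.card_eq_fintype_card, ← Set.toFinset_card]
    congr 1
    ext e
    rw [Set.mem_toFinset, SimpleGraph.incidenceSet, erGraph, SimpleGraph.edgeSet_fromEdgeSet]
    simp only [Set.mem_ofPred_eq, Set.mem_sdiff, Sym2.mem_diagSet, Finset.mem_filter,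
      Finset.mem_univ, true_and]
    tauto
  rw [hcard, ← Finset.prod_const, Finset.prod_filter, degreeSign]
  refine Finset.prod_congr rfl fun e _ => ?_
  by_cases h : v ∈ e ∧ ¬ e.IsDiag <;> simp [h, edgeSign]

theorem oddCount_eq_sum_degreeSign (n : ℕ) (ω : Sym2 (Fin n) → Bool) :
    (oddCount n ω : ℝ) = (n - ∑ v, degreeSign v ω) / 2 := by
  classical
  have h : ∀ v, (if Odd (degN (erGraph n ω) v) then (1 : ℝ) else 0) =
      (1 - degreeSign v ω) / 2 := by
    intro v
    rw [degreeSign_eq_neg_one_pow]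
    split_ifs with hv
    · rw [hv.neg_one_pow]; norm_num
    · rw [(Nat.not_odd_iff_even.mp hv).neg_one_pow]; norm_num
  rw [oddCount, Nat.card_eq_fintype_card, Fintype.card_subtype, Finset.card_filter]
  push_cast
  rw [Finset.sum_congr rfl fun v _ => h v, ← Finset.sum_div, Finset.sum_sub_distrib]
  simp

theorem prod_degreeSign {n k : ℕ} (v : Fin k → Fin n) (ω : Sym2 (Fin n) → Bool) :
    ∏ i, degreeSign (v i) ω = ∏ e, edgeSign (ω e) ^ incidenceCount v e := by
  classical
  unfold degreeSign incidenceCount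
  rw [Finset.prod_comm]
  refine Finset.prod_congr rfl fun e _ => ?_
  rw [← Finset.prod_const, Finset.prod_filter]

theorem integral_prod_degreeSign {n k : ℕ} (p : ℝ) (v : Fin k → Fin n) :
    ∫ ω, ∏ i, degreeSign (v i) ω ∂erMeasure n p =
      ∏ e, ∫ b, edgeSign b ^ incidenceCount v e ∂bern p := by
  simp_rw [prod_degreeSign, erMeasure]
  exact integral_fintype_prod_eq_prod (fun e b => edgeSign b ^ incidenceCount v e)

theorem abs_integral_prod_degreeSign_le_one {n k : ℕ} {p : ℝ} (h0 : 0 ≤ p) (h1 : p ≤ 1)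
    (v : Fin k → Fin n) : |∫ ω, ∏ i, degreeSign (v i) ω ∂erMeasure n p| ≤ 1 := by
  rw [integral_prod_degreeSign, Finset.abs_prod]
  exact Finset.prod_le_one (fun _ _ => abs_nonneg _)
    fun e _ => abs_integral_edgeSign_pow_le_one h0 h1 _

theorem incidenceCount_of_notMem_range {n k : ℕ} {v : Fin k → Fin n} {w u : Fin n}
    (hu : u ∉ Finset.univ.image v) (hwu : w ≠ u) :
    incidenceCount v s(w, u) = (Finset.univ.filter fun i => v i = w).card := by
  classical
  unfold incidenceCount
  congr 1
  ext i
  have : v i ≠ u := fun h => hu (Finset.mem_image.mpr ⟨i, Finset.mem_univ _, h⟩)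
  simp [this, hwu]

/-- If some vertex `w` occurs an odd number of times in `v`, each edge from `w` to a vertex
outside the tuple contributes a factor `1 - 2p` to the expectation. -/
theorem abs_integral_prod_degreeSign_le {n k : ℕ} {p : ℝ} (h0 : 0 ≤ p) (h1 : p ≤ 1)
    (v : Fin k → Fin n) {w : Fin n} (hw : Odd (Finset.univ.filter fun i => v i = w).card) :
    |∫ ω, ∏ i, degreeSign (v i) ω ∂erMeasure n p| ≤ |1 - 2 * p| ^ (n - k) := by
  classical
  rw [integral_prod_degreeSign, Finset.abs_prod]
  set s : Finset (Fin n) := (Finset.univ.image v)ᶜ with hs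
  have hws : ∀ u ∈ s, w ≠ u := by
    rintro u hu rfl
    obtain ⟨i, hi⟩ := Finset.card_pos.mp hw.pos
    refine Finset.mem_compl.mp hu (Finset.mem_image.mpr ⟨i, Finset.mem_univ _, ?_⟩)
    simpa using hi
  have hscard : n - k ≤ s.card := by
    have : (Finset.univ.image v).card ≤ k := Finset.card_image_le.trans (by simp)
    rw [hs, Finset.card_compl, Fintype.card_fin]
    omega
  have hinj : Set.InjOn (fun u => s(w, u)) s := fun a _ b _ h => Sym2.congr_right.mp h
  calc ∏ e, |∫ b, edgeSign b ^ incidenceCount v e ∂bern p|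
      ≤ ∏ e ∈ s.image fun u => s(w, u), |∫ b, edgeSign b ^ incidenceCount v e ∂bern p| :=
        Finset.prod_le_prod_of_subset_of_le_one (Finset.subset_univ _)
          (fun _ _ => abs_nonneg _) fun e _ _ => abs_integral_edgeSign_pow_le_one h0 h1 _
    _ = ∏ _u ∈ s, |1 - 2 * p| := by
        rw [Finset.prod_image hinj]
        refine Finset.prod_congr rfl fun u hu => ?_
        rw [incidenceCount_of_notMem_range (Finset.mem_compl.mp hu) (hws u hu)]
        exact abs_integral_edgeSign_pow_odd h0 h1 hw
    _ = |1 - 2 * p| ^ s.card := by rw [Finset.prod_const]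
    _ ≤ |1 - 2 * p| ^ (n - k) :=
        pow_le_pow_of_le_one (abs_nonneg _) (abs_le.mpr ⟨by linarith, by linarith⟩) hscard

/-- A tuple in which every value occurs an even number of times takes at most half as many
values as its length. -/
theorem two_mul_card_image_le {n k : ℕ} {v : Fin k → Fin n}
    (hv : ∀ w, Even (Finset.univ.filter fun i => v i = w).card) :
    2 * (Finset.univ.image v).card ≤ k := by
  have h := Finset.card_eq_sum_card_image v (Finset.univ : Finset (Fin k))
  rw [Finset.card_univ, Fintype.card_fin] at h
  rw [mul_comm]
  refine le_of_le_of_eq ?_ h.symm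
  refine Finset.card_nsmul_le_sum _ _ 2 fun w hw => ?_
  obtain ⟨i, -, hi⟩ := Finset.mem_image.mp hw
  have hpos : 0 < (Finset.univ.filter fun i => v i = w).card :=
    Finset.card_pos.mpr ⟨i, by simpa using hi⟩
  obtain ⟨c, hc⟩ := hv w
  omega

theorem card_filter_even_fibers_le {n : ℕ} (hn : 0 < n) (m : ℕ) :
    (Finset.univ.filter fun v : Fin (2 * m) → Fin n =>
      ∀ w, Even (Finset.univ.filter fun i => v i = w).card).card ≤ m ^ (2 * m) * n ^ m := by
  classical
  have hsub : (Finset.univ.filter fun v : Fin (2 * m) → Fin n =>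
      ∀ w, Even (Finset.univ.filter fun i => v i = w).card) ⊆
      (Finset.univ : Finset ((Fin (2 * m) → Fin m) × (Fin m → Fin n))).image
        fun x => x.2 ∘ x.1 := by
    intro v hv
    have hcard : (Finset.univ.image v).card ≤ m := by
      have := two_mul_card_image_le (Finset.mem_filter.mp hv).2
      omega
    have hmem : ∀ i, v i ∈ Finset.univ.image v :=
      fun i => Finset.mem_image_of_mem v (Finset.mem_univ i)
    let φ := (Finset.univ.image v).equivFin
    let g : Fin m → Fin n := fun j =>
      if h : j.1 < (Finset.univ.image v).card then (φ.symm ⟨j.1, h⟩).1 else ⟨0, hn⟩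
    refine Finset.mem_image.mpr
      ⟨(fun i => Fin.castLE hcard (φ ⟨v i, hmem i⟩), g), Finset.mem_univ _, ?_⟩
    ext i
    simp [g]
  refine (Finset.card_le_card hsub).trans (Finset.card_image_le.trans ?_)
  simp

theorem pow_sub_le_of_abs_one_sub_two_mul {n k : ℕ} {p : ℝ} (hn : 0 < n) (hkn : 2 * k ≤ n)
    (hlog : (k : ℝ) ≤ Real.log n) (hp : (Real.log n) ^ 2 / n ≤ p)
    (hp' : p ≤ 1 - (Real.log n) ^ 2 / n) : |1 - 2 * p| ^ (n - k) ≤ ((n : ℝ) ^ k)⁻¹ := by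
  have hn' : (0 : ℝ) < n := by exact_mod_cast hn
  set L := Real.log n
  have hbase : |1 - 2 * p| ≤ Real.exp (-(2 * (L ^ 2 / n))) := by
    have h := Real.add_one_le_exp (-(2 * (L ^ 2 / n)))
    rw [abs_le]
    constructor <;> linarith
  have hk : (n : ℝ) / 2 ≤ ((n - k : ℕ) : ℝ) := by
    rw [Nat.cast_sub (by omega)]
    have : (2 : ℝ) * k ≤ n := by exact_mod_cast hkn
    linarith
  calc |1 - 2 * p| ^ (n - k) ≤ Real.exp (-(2 * (L ^ 2 / n))) ^ (n - k) :=
        pow_le_pow_left₀ (abs_nonneg _) hbase _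
    _ = Real.exp (-(((n - k : ℕ) : ℝ) * (2 * (L ^ 2 / n)))) := by
        rw [← Real.exp_nat_mul, mul_neg]
    _ ≤ Real.exp (-(k * L)) := by
        refine Real.exp_le_exp.mpr (neg_le_neg ?_)
        calc (k : ℝ) * L ≤ L * L :=
              mul_le_mul_of_nonneg_right hlog ((Nat.cast_nonneg k).trans hlog)
          _ = (n : ℝ) / 2 * (2 * (L ^ 2 / n)) := by field_simp
          _ ≤ _ := mul_le_mul_of_nonneg_right hk (by positivity)
    _ = ((n : ℝ) ^ k)⁻¹ := by
        rw [Real.exp_neg, Real.exp_nat_mul, Real.exp_log hn']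

theorem integral_sum_degreeSign_pow_le {n m : ℕ} {p : ℝ} (hn : 0 < n) (hmn : 2 * (2 * m) ≤ n)
    (hlog : ((2 * m : ℕ) : ℝ) ≤ Real.log n) (hp : (Real.log n) ^ 2 / n ≤ p)
    (hp' : p ≤ 1 - (Real.log n) ^ 2 / n) :
    ∫ ω, (∑ v, degreeSign v ω) ^ (2 * m) ∂erMeasure n p ≤ (m : ℝ) ^ (2 * m) * n ^ m + 1 := by
  classical
  have h0 : 0 ≤ p := le_trans (by positivity) hp
  have h1 : p ≤ 1 := hp'.trans (sub_le_self _ (by positivity))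
  have hn' : (0 : ℝ) < n := by exact_mod_cast hn
  have := isProbabilityMeasure_erMeasure n h0 h1
  simp_rw [Fintype.sum_pow]
  rw [integral_finsetSum _ fun _ _ => .of_finite]
  set b : ℝ := ((n : ℝ) ^ (2 * m))⁻¹
  have hb : 0 ≤ b := by positivity
  have hterm : ∀ v : Fin (2 * m) → Fin n, ∫ ω, ∏ i, degreeSign (v i) ω ∂erMeasure n p ≤
      (if ∀ w, Even (Finset.univ.filter fun i => v i = w).card then 1 else 0) + b := by
    intro v
    refine (le_abs_self _).trans ?_
    split_ifs with hv
    · exact (abs_integral_prod_degreeSign_le_one h0 h1 v).trans (by linarith)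
    · push Not at hv
      obtain ⟨w, hw⟩ := hv
      rw [zero_add]
      exact (abs_integral_prod_degreeSign_le h0 h1 v (by simpa using hw)).trans
        (pow_sub_le_of_abs_one_sub_two_mul hn hmn hlog hp hp')
  refine (Finset.sum_le_sum fun v _ => hterm v).trans ?_
  rw [Finset.sum_add_distrib, Finset.sum_boole, Finset.sum_const, Finset.card_univ]
  have hcount := card_filter_even_fibers_le hn m
  have hcount' : ((Finset.univ.filter fun v : Fin (2 * m) → Fin n =>
      ∀ w, Even (Finset.univ.filter fun i => v i = w).card).card : ℝ) ≤
      (m : ℝ) ^ (2 * m) * n ^ m := by exact_mod_cast hcount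
  refine add_le_add hcount' (le_of_eq ?_)
  simp only [Fintype.card_pi, Fintype.card_fin, Finset.prod_const, Finset.card_univ,
    nsmul_eq_mul, Nat.cast_pow, b]
  exact mul_inv_cancel₀ (by positivity)

theorem abs_integral_sum_degreeSign_le {n : ℕ} {p : ℝ} (hn : 2 ≤ n) (hlog : 1 ≤ Real.log n)
    (hp : (Real.log n) ^ 2 / n ≤ p) (hp' : p ≤ 1 - (Real.log n) ^ 2 / n) :
    |∫ ω, ∑ v, degreeSign v ω ∂erMeasure n p| ≤ 1 := by
  have h0 : 0 ≤ p := le_trans (by positivity) hp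
  have h1 : p ≤ 1 := hp'.trans (sub_le_self _ (by positivity))
  have hn' : (0 : ℝ) < n := by exact_mod_cast (by omega : 0 < n)
  have := isProbabilityMeasure_erMeasure n h0 h1
  rw [integral_finsetSum _ fun _ _ => .of_finite]
  refine (Finset.abs_sum_le_sum_abs _ _).trans ?_
  have hterm : ∀ v : Fin n, |∫ ω, degreeSign v ω ∂erMeasure n p| ≤ (n : ℝ)⁻¹ := by
    intro v
    have h := (abs_integral_prod_degreeSign_le h0 h1 (fun _ : Fin 1 => v) (w := v) (by simp)).trans
      (pow_sub_le_of_abs_one_sub_two_mul (by omega) (by omega) (by simpa using hlog) hp hp')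
    simpa using h
  refine (Finset.sum_le_sum fun v _ => hterm v).trans (le_of_eq ?_)
  simp [hn'.ne']

/-- Central moment bound: for every fixed even `q ≥ 2` there is `D = D(q)` with
`E[(T-μ)^q] ≤ D n^(q/2)` for all large `n`, where `T` is the number of odd-degree
vertices and `μ = E[T]`. -/
theorem central_moment_bound (q : ℕ) (hq : 2 ≤ q) (hqe : Even q) :
    ∃ D : ℝ, 0 < D ∧ ∃ n0 : ℕ, ∀ n : ℕ, n0 ≤ n → ∀ p : ℝ,
      (Real.log n) ^ 2 / n ≤ p → p ≤ 1 - (Real.log n) ^ 2 / n →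
      (∫ ω, ((oddCount n ω : ℝ) - ∫ ω', (oddCount n ω' : ℝ) ∂ erMeasure n p) ^ q
          ∂ erMeasure n p)
        ≤ D * (n : ℝ) ^ ((q : ℝ) / 2) := by
  obtain ⟨m, rfl⟩ := hqe.two_dvd
  have hlarge : ∀ᶠ n : ℕ in Filter.atTop, ((2 * m : ℕ) : ℝ) ≤ Real.log n :=
    (Real.tendsto_log_atTop.comp tendsto_natCast_atTop_atTop).eventually_ge_atTop _
  obtain ⟨n1, hn1⟩ := Filter.eventually_atTop.mp hlarge
  refine ⟨(m : ℝ) ^ (2 * m) + 2, by positivity, max n1 (2 * (2 * m)), fun n hn p hp hp' => ?_⟩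
  have hlog := hn1 n ((le_max_left _ _).trans hn)
  have hmn : 2 * (2 * m) ≤ n := (le_max_right _ _).trans hn
  have hlog1 : 1 ≤ Real.log n := le_trans (by exact_mod_cast (by omega : 1 ≤ 2 * m)) hlog
  have h0 : 0 ≤ p := le_trans (by positivity) hp
  have h1 : p ≤ 1 := hp'.trans (sub_le_self _ (by positivity))
  have := isProbabilityMeasure_erMeasure n h0 h1
  have hn' : (1 : ℝ) ≤ n := by exact_mod_cast (by omega : 1 ≤ n)
  have hmoment := integral_sum_degreeSign_pow_le (by omega) hmn hlog hp hp'
  have hmean := abs_integral_sum_degreeSign_le (by omega) hlog1 hp hp'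
  set M := ∫ ω, ∑ v, degreeSign v ω ∂erMeasure n p with hM
  have hμ : ∫ ω, (oddCount n ω : ℝ) ∂erMeasure n p = (n - M) / 2 := by
    simp_rw [oddCount_eq_sum_degreeSign]
    rw [integral_div, integral_sub .of_finite .of_finite, ← hM]
    simp
  have hpoint : ∀ ω, ((oddCount n ω : ℝ) - (n - M) / 2) ^ (2 * m) ≤
      (∑ v, degreeSign v ω) ^ (2 * m) + 1 := by
    intro ω
    have hMpow : M ^ (2 * m) ≤ 1 := by
      rw [← (even_two_mul m).pow_abs]
      exact pow_le_one₀ (abs_nonneg _) hmean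
    have hsum := (even_two_mul m).add_pow_le (a := M / 2) (b := -(∑ v, degreeSign v ω) / 2)
    rw [oddCount_eq_sum_degreeSign, show ∀ s : ℝ, ((n : ℝ) - s) / 2 - (n - M) / 2 =
      M / 2 + -s / 2 from fun s => by ring]
    refine hsum.trans ?_
    rw [div_pow, div_pow, (even_two_mul m).neg_pow, ← add_div, mul_div_left_comm]
    have hS : 0 ≤ (∑ v, degreeSign v ω) ^ (2 * m) := (even_two_mul m).pow_nonneg _
    have hM0 : 0 ≤ M ^ (2 * m) := (even_two_mul m).pow_nonneg _
    have hquot : (2 : ℝ) ^ (2 * m - 1) / 2 ^ (2 * m) ≤ 1 :=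
      div_le_one_of_le₀ (pow_le_pow_right₀ one_le_two (Nat.sub_le _ _)) (by positivity)
    exact (mul_le_of_le_one_right (add_nonneg hM0 hS) hquot).trans (by linarith)
  have hpow : (n : ℝ) ^ (((2 * m : ℕ) : ℝ) / 2) = (n : ℝ) ^ m := by
    rw [← Real.rpow_natCast]
    congr 1
    push_cast
    ring
  rw [hμ, hpow]
  calc ∫ ω, ((oddCount n ω : ℝ) - (n - M) / 2) ^ (2 * m) ∂erMeasure n p
      ≤ ∫ ω, ((∑ v, degreeSign v ω) ^ (2 * m) + 1) ∂erMeasure n p :=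
        integral_mono .of_finite .of_finite hpoint
    _ = (∫ ω, (∑ v, degreeSign v ω) ^ (2 * m) ∂erMeasure n p) + 1 := by
        rw [integral_add .of_finite .of_finite]
        simp
    _ ≤ (m : ℝ) ^ (2 * m) * n ^ m + 1 + 1 := by gcongr
    _ ≤ ((m : ℝ) ^ (2 * m) + 2) * n ^ m := by
        have := one_le_pow₀ hn' (n := m)
        linarith
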